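/- arXiv:2501.03216 — 2 statements merged into one kernel-verified Lean document; each statement's English description precedes it below -/
import Mathlib

section
/- Let r ≥ 2 be an integer, let H_1, …, H_n be matchings, each of size N, in an r-uniform hypergraph, and let M be a rainbow matching of maximum size m for this collection, using a set C ⊆ {1,…,n} of m colours (one edge of M from H_c for each c ∈ C). For an index i ∉ C, call an edge e ∈ M good for i if there exist two distinct edges f_1, f_2 ∈ H_i with f_1 ∩ V(M) ⊆ e and f_2 ∩ V(M) ⊆ e, where V(M) is the set of vertices covered by M. Then for every i ∉ C, the number g_i of edges of M that are good for i satisfies (r−1)·g_i ≥ 2N − (r+1)·m. -/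
/-- `A` is a matching consisting of `r`-element edges: every edge has exactly `r`
vertices and distinct edges are pairwise disjoint. -/
def IsMatching {V : Type*} (r : ℕ) (A : Finset (Finset V)) : Prop :=
  (∀ e ∈ A, e.card = r) ∧ ∀ e ∈ A, ∀ f ∈ A, e ≠ f → Disjoint e f

/-- The collection of matchings `M 0, …, M (n-1)` admits a rainbow matching of size `s`:
there are `s` pairwise disjoint edges together with an injective assignment of colours
such that each edge lies in the matching of its assigned colour. -/
def HasRainbow {V : Type*} {n : ℕ} (M : Fin n → Finset (Finset V)) (s : ℕ) : Prop :=
  ∃ (c : Fin s → Fin n) (e : Fin s → Finset V),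
    Function.Injective c ∧ (∀ j, e j ∈ M (c j)) ∧
      ∀ j k, j ≠ k → Disjoint (e j) (e k)

/-- With respect to the partition of the vertex set given by `P : V → Fin r`,
the edge `e` contains exactly one vertex from each part. -/
def IsPartiteEdge {V : Type*} (r : ℕ) (P : V → Fin r) (e : Finset V) : Prop :=
  ∀ k : Fin r, (e.filter fun v => P v = k).card = 1

open Classical in
/-- The traces of the edges of a matching on a finite set `S` have total size at most `S.card`. -/
theorem IsMatching.sum_card_inter_le {V : Type*} {r : ℕ} {A : Finset (Finset V)}
    (hA : IsMatching r A) (S : Finset V) : ∑ f ∈ A, (f ∩ S).card ≤ S.card := by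
  rw [← Finset.card_biUnion]
  · exact Finset.card_le_card (Finset.biUnion_subset.2 fun f _ => Finset.inter_subset_right)
  · intro f hf g hg hfg
    exact (hA.2 f hf g hg hfg).mono Finset.inter_subset_left Finset.inter_subset_left

theorem IsMatching.mono {V : Type*} {r : ℕ} {A B : Finset (Finset V)}
    (hA : IsMatching r A) (hBA : B ⊆ A) : IsMatching r B :=
  ⟨fun e he => hA.1 e (hBA he), fun e he f hf => hA.2 e (hBA he) f (hBA hf)⟩

open Classical in
/-- A rainbow matching `M` can be extended by an edge of an unused colour that is disjoint
from all edges of `M`. -/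
theorem HasRainbow.of_disjoint_edge {V : Type*} {n : ℕ} {H : Fin n → Finset (Finset V)}
    {M : Finset (Finset V)} {col : Finset V → Fin n}
    (hM : ∀ e ∈ M, ∀ f ∈ M, e ≠ f → Disjoint e f) (hcol : ∀ e ∈ M, e ∈ H (col e))
    (hinj : Set.InjOn col ↑M) {i : Fin n} (hi : ∀ e ∈ M, col e ≠ i) {f : Finset V}
    (hf : f ∈ H i) (hfM : f ∉ M) (hdisj : ∀ e ∈ M, Disjoint f e) :
    HasRainbow H (M.card + 1) := by
  let φ := (insert f M).equivFinOfCardEq (Finset.card_insert_of_notMem hfM)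
  have hmem : ∀ j, (φ.symm j : Finset V) = f ∨ (φ.symm j : Finset V) ∈ M := fun j =>
    Finset.mem_insert.1 (φ.symm j).2
  have hne : ∀ e ∈ M, e ≠ f := fun e he h => hfM (h ▸ he)
  have heq : ∀ {j k}, (φ.symm j : Finset V) = φ.symm k → j = k := fun h =>
    φ.symm.injective (Subtype.ext h)
  refine ⟨fun j => if (φ.symm j : Finset V) = f then i else col (φ.symm j),
    fun j => φ.symm j, ?_, ?_, ?_⟩
  · intro j k hjk
    apply heq
    rcases hmem j with hj | hj <;> rcases hmem k with hk | hk
    · rw [hj, hk]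
    · simp only [if_pos hj, if_neg (hne _ hk)] at hjk
      exact absurd hjk.symm (hi _ hk)
    · simp only [if_neg (hne _ hj), if_pos hk] at hjk
      exact absurd hjk (hi _ hj)
    · simp only [if_neg (hne _ hj), if_neg (hne _ hk)] at hjk
      exact hinj hj hk hjk
  · intro j
    rcases hmem j with hj | hj
    · simpa only [hj, if_true] using hf
    · simpa only [if_neg (hne _ hj)] using hcol _ hj
  · intro j k hjk
    have hjk' : (φ.symm j : Finset V) ≠ φ.symm k := fun h => hjk (heq h)
    rcases hmem j with hj | hj <;> rcases hmem k with hk | hk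
    · exact absurd (hj.trans hk.symm) hjk'
    · simpa only [hj] using hdisj _ hk
    · simpa only [hk] using (hdisj _ hj).symm
    · exact hM _ hj _ hk hjk'

open Classical in
/-- If every edge of a matching `A` meets the vertex set of the matching `M`, then counting
the pairs `(e, f)` for which the trace of `f ∈ A` on that vertex set lies inside `e ∈ M`
bounds `A.card` from above. -/
theorem IsMatching.two_mul_card_le {V : Type*} {r : ℕ} {A M : Finset (Finset V)}
    (hA : IsMatching r A) (hM : IsMatching r M)
    (hmeet : ∀ f ∈ A, (f ∩ M.biUnion id).Nonempty) :
    2 * A.card ≤ r * M.card + ∑ e ∈ M, (A.filter fun f => f ∩ M.biUnion id ⊆ e).card := by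
  have hcard : (M.biUnion id).card ≤ r * M.card := by
    rw [mul_comm]
    exact Finset.card_biUnion_le_card_mul _ _ _ fun e he => (hM.1 e he).le
  have hswap : ∑ e ∈ M, (A.filter fun f => f ∩ M.biUnion id ⊆ e).card =
      ∑ f ∈ A, (M.filter fun e => f ∩ M.biUnion id ⊆ e).card := by
    simp only [Finset.card_filter]
    exact Finset.sum_comm
  have hpoint : ∀ f ∈ A, 2 ≤ (f ∩ M.biUnion id).card +
      (M.filter fun e => f ∩ M.biUnion id ⊆ e).card := by
    intro f hf
    have hpos := (hmeet f hf).card_pos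
    by_cases h1 : (f ∩ M.biUnion id).card = 1
    · obtain ⟨v, hv⟩ := Finset.card_eq_one.1 h1
      have hvU : v ∈ M.biUnion id :=
        Finset.inter_subset_right (hv ▸ Finset.mem_singleton_self v)
      obtain ⟨e, he, hve⟩ := Finset.mem_biUnion.1 hvU
      have : 0 < (M.filter fun e => f ∩ M.biUnion id ⊆ e).card :=
        Finset.card_pos.2 ⟨e, Finset.mem_filter.2
          ⟨he, by rw [hv]; exact Finset.singleton_subset_iff.2 hve⟩⟩
      omega
    · omega
  have hsum := Finset.sum_le_sum hpoint
  rw [Finset.sum_add_distrib, Finset.sum_const, smul_eq_mul, ← hswap] at hsum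
  have := hA.sum_card_inter_le (M.biUnion id)
  omega

/-- Claim 2.3: for every colour i not used by a maximum rainbow matching M of size m,
the number g_i of edges of M that are good for i satisfies (r-1)·g_i ≥ 2N - (r+1)m. -/
theorem stmt3 {V : Type*} (r n N m : ℕ) (hr : 2 ≤ r)
    (H : Fin n → Finset (Finset V))
    (hH : ∀ i, IsMatching r (H i) ∧ (H i).card = N)
    (M : Finset (Finset V)) (hMmatch : IsMatching r M) (hMcard : M.card = m)
    (C : Finset (Fin n)) (hCcard : C.card = m)
    (col : Finset V → Fin n)
    (hcol : ∀ e ∈ M, col e ∈ C ∧ e ∈ H (col e))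
    (hinj : Set.InjOn col ↑M)
    (hmax : ∀ s, HasRainbow H s → s ≤ m) :
    ∀ i : Fin n, i ∉ C →
      ((r : ℤ) - 1) *
          (Set.ncard {e : Finset V | e ∈ M ∧ ∃ f₁ ∈ H i, ∃ f₂ ∈ H i, f₁ ≠ f₂ ∧
            ((f₁ : Set V) ∩ {v | ∃ g ∈ M, v ∈ g}) ⊆ (e : Set V) ∧
            ((f₂ : Set V) ∩ {v | ∃ g ∈ M, v ∈ g}) ⊆ (e : Set V)} : ℤ) ≥
        2 * N - ((r : ℤ) + 1) * m := by
  classical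
  intro i hiC
  obtain ⟨hHi, hHN⟩ := hH i
  set U := M.biUnion id with hU
  have hmeet : ∀ f ∈ H i, (f ∩ U).Nonempty := by
    intro f hf
    by_contra hempty
    rw [Finset.not_nonempty_iff_eq_empty, ← Finset.disjoint_iff_inter_eq_empty, hU,
      Finset.disjoint_biUnion_right] at hempty
    have hfM : f ∉ M := fun hfM => by
      have h0 : f = ∅ := Finset.disjoint_self_iff_empty f |>.1 (hempty f hfM)
      have := hHi.1 f hf
      rw [h0, Finset.card_empty] at this
      omega
    have := hmax _ (HasRainbow.of_disjoint_edge hMmatch.2 (fun e he => (hcol e he).2) hinj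
      (i := i) (fun e he h => hiC (h ▸ (hcol e he).1)) hf hfM hempty)
    omega
  set a : Finset V → Finset (Finset V) := fun e => (H i).filter fun f => f ∩ U ⊆ e with ha
  have hle : ∀ e ∈ M, (a e).card ≤ r := by
    intro e he
    have haH : a e ⊆ H i := Finset.filter_subset _ _
    rw [← hMmatch.1 e he]
    refine le_trans ?_ ((hHi.mono haH).sum_card_inter_le e)
    rw [Finset.card_eq_sum_ones]
    refine Finset.sum_le_sum fun f hf => ?_
    obtain ⟨hfH, hfe⟩ := Finset.mem_filter.1 hf
    exact Finset.card_pos.2 ((hmeet f hfH).mono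
      (Finset.subset_inter Finset.inter_subset_left hfe))
  have hgood : {e : Finset V | e ∈ M ∧ ∃ f₁ ∈ H i, ∃ f₂ ∈ H i, f₁ ≠ f₂ ∧
      ((f₁ : Set V) ∩ {v | ∃ g ∈ M, v ∈ g}) ⊆ (e : Set V) ∧
      ((f₂ : Set V) ∩ {v | ∃ g ∈ M, v ∈ g}) ⊆ (e : Set V)} =
      ↑(M.filter fun e => 1 < (a e).card) := by
    have hUset : {v | ∃ g ∈ M, v ∈ g} = (U : Set V) := by ext v; simp [hU]
    ext e
    simp only [hUset, ← Finset.coe_inter, Finset.coe_subset, Set.mem_ofPred_eq,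
      Finset.coe_filter, Finset.one_lt_card, ha, Finset.mem_filter]
    refine and_congr_right fun _ => ⟨?_, ?_⟩
    · rintro ⟨f₁, h₁, f₂, h₂, hne, s₁, s₂⟩
      exact ⟨f₁, ⟨h₁, s₁⟩, f₂, ⟨h₂, s₂⟩, hne⟩
    · rintro ⟨f₁, ⟨h₁, s₁⟩, f₂, ⟨h₂, s₂⟩, hne⟩
      exact ⟨f₁, h₁, f₂, h₂, hne, s₁, s₂⟩
  rw [hgood, Set.ncard_coe_finset]
  have hsum : ∑ e ∈ M, ((a e).card : ℤ) ≤
      ∑ e ∈ M, (1 + ((r : ℤ) - 1) * if 1 < (a e).card then 1 else 0) := by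
    refine Finset.sum_le_sum fun e he => ?_
    have := hle e he
    split_ifs <;> simp only [mul_one, mul_zero] <;> omega
  rw [Finset.sum_add_distrib, ← Finset.mul_sum, Finset.sum_boole, Finset.sum_const,
    nsmul_one, hMcard] at hsum
  have hcount := hHi.two_mul_card_le hMmatch hmeet
  rw [hHN, hMcard] at hcount
  zify at hcount
  linarith
end

section
/- For every integer r ≥ 3 and every integer n > 6^r, there exists an r-partite r-uniform hypergraph and a collection of n matchings in it, each of size n + m where m = ⌈(1/(12r))·n^{(r−1)/r}⌉ − 1, that does not admit a rainbow matching of size n; equivalently, h(r,n) ≥ n + (1/(12r))·n^{(r−1)/r}. -/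
open Finset in
/-- The number of permutations mapping a given set `S` into a given set `T`. -/
theorem card_perm_mapsTo_mul_choose {N : ℕ} (S T : Finset (Fin N)) :
    #{σ : Equiv.Perm (Fin N) | ∀ x ∈ S, σ x ∈ T} * N.choose #S =
      N.factorial * (#T).choose #S := by
  have indep : ∀ S' ∈ powersetCard #S (univ : Finset (Fin N)),
      #{σ : Equiv.Perm (Fin N) | ∀ x ∈ S', σ x ∈ T} =
        #{σ : Equiv.Perm (Fin N) | ∀ x ∈ S, σ x ∈ T} := by
    intro S' hS'
    rw [mem_powersetCard_univ] at hS'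
    set e : S ≃ S' := Finset.equivOfCardEq hS'.symm
    set p : Equiv.Perm (Fin N) := Equiv.extendSubtype e
    have hp : ∀ x, p x ∈ S' ↔ x ∈ S := fun x =>
      ⟨fun h => by
        by_contra hx
        exact Equiv.extendSubtype_not_mem e x hx h, Equiv.extendSubtype_mem e x⟩
    refine Finset.card_bij' (fun σ _ => σ * p) (fun σ _ => σ * p⁻¹) ?_ ?_ ?_ ?_
    · intro σ hσ
      simp only [mem_filter_univ] at hσ ⊢
      exact fun x hx => hσ _ ((hp x).2 hx)
    · intro σ hσ
      simp only [mem_filter_univ] at hσ ⊢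
      exact fun x hx => hσ _ ((hp _).1 (by simpa using hx))
    · intro σ _; simp
    · intro σ _; simp
  have key := Finset.sum_card_bipartiteAbove_eq_sum_card_bipartiteBelow
    (s := powersetCard #S (univ : Finset (Fin N)))
    (t := (univ : Finset (Equiv.Perm (Fin N)))) (fun S' σ => ∀ x ∈ S', σ x ∈ T)
  have below : ∀ σ ∈ (univ : Finset (Equiv.Perm (Fin N))),
      #(bipartiteBelow (fun S' (σ : Equiv.Perm (Fin N)) => ∀ x ∈ S', σ x ∈ T)
        (powersetCard #S (univ : Finset (Fin N))) σ) = (#T).choose #S := by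
    intro σ _
    have : bipartiteBelow (fun S' (σ : Equiv.Perm (Fin N)) => ∀ x ∈ S', σ x ∈ T)
        (powersetCard #S (univ : Finset (Fin N))) σ =
        powersetCard #S (T.map σ.symm.toEmbedding) := by
      ext S'
      simp only [bipartiteBelow, mem_filter, mem_powersetCard,
        subset_iff, mem_map_equiv, Equiv.symm_symm]
      grind
    rw [this, card_powersetCard, card_map]
  rw [Finset.sum_congr rfl below] at key
  simp only [bipartiteAbove] at key
  rw [Finset.sum_congr rfl indep] at key
  simpa [Fintype.card_perm, mul_comm] using key

open Finset in
/-- If `N.choose k` is large, some pair of permutations expands every `k`-set. -/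
theorem exists_perm_pair_expanding {N k m : ℕ} (hk : k ≤ N)
    (h : N.choose m * ((k + m).choose k) ^ 2 < N.choose k) :
    ∃ σ τ : Equiv.Perm (Fin N), ∀ S T : Finset (Fin N), #S = k → #T = k + m → S ⊆ T →
      (∀ x ∈ S, σ x ∈ T) → ¬ ∀ x ∈ S, τ x ∈ T := by
  by_contra! hcon
  set f : Finset (Fin N) × Finset (Fin N) → Finset (Equiv.Perm (Fin N)) := fun q =>
    {σ | ∀ x ∈ q.1, σ x ∈ q.1 ∪ q.2} with hf
  set I := powersetCard k (univ : Finset (Fin N)) ×ˢ powersetCard m (univ : Finset (Fin N))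
    with hI
  have cover : (univ : Finset (Equiv.Perm (Fin N) × Equiv.Perm (Fin N))) ⊆
      I.biUnion fun q => f q ×ˢ f q := by
    rintro ⟨σ, τ⟩ -
    obtain ⟨S, T, hS, hT, hST, h1, h2⟩ := hcon σ τ
    refine mem_biUnion.2 ⟨(S, T \ S), ?_, ?_⟩
    · simp only [hI, mem_product, mem_powersetCard_univ]
      exact ⟨hS, by rw [card_sdiff_of_subset hST]; omega⟩
    · simp only [hf, mem_product, mem_filter_univ, union_sdiff_of_subset hST]
      exact ⟨h1, h2⟩
  have bound : ∀ q ∈ I, #(f q) * N.choose k ≤ N.factorial * (k + m).choose k := by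
    rintro ⟨S, D⟩ hq
    simp only [hI, mem_product, mem_powersetCard_univ] at hq
    have := card_perm_mapsTo_mul_choose S (S ∪ D)
    rw [hq.1] at this
    rw [hf, this]
    refine Nat.mul_le_mul_left _ (Nat.choose_le_choose _ ?_)
    calc #(S ∪ D) ≤ #S + #D := card_union_le _ _
      _ = k + m := by rw [hq.1, hq.2]
  have hcard : N.factorial ^ 2 ≤ ∑ q ∈ I, #(f q) ^ 2 := by
    have := (card_le_card cover).trans card_biUnion_le
    simpa [Fintype.card_perm, sq] using this
  have hmul : N.factorial ^ 2 * N.choose k ^ 2 ≤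
      (N.choose k * N.choose m) * (N.factorial * (k + m).choose k) ^ 2 := by
    calc N.factorial ^ 2 * N.choose k ^ 2 ≤ (∑ q ∈ I, #(f q) ^ 2) * N.choose k ^ 2 :=
          Nat.mul_le_mul_right _ hcard
      _ = ∑ q ∈ I, (#(f q) * N.choose k) ^ 2 := by
          rw [sum_mul]; simp only [mul_pow]
      _ ≤ ∑ q ∈ I, (N.factorial * (k + m).choose k) ^ 2 :=
          sum_le_sum fun q hq => Nat.pow_le_pow_left (bound q hq) 2
      _ = _ := by simp [hI]
  have hpos : 0 < N.factorial ^ 2 * N.choose k :=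
    Nat.mul_pos (pow_pos N.factorial_pos 2) (Nat.choose_pos hk)
  have := Nat.mul_lt_mul_of_pos_left h hpos
  nlinarith [this, hmul]

theorem two_pow_le_choose_half (N : ℕ) : 2 ^ (N / 2) ≤ N.choose (N / 2) := by
  have h : ∀ k : ℕ, 2 ^ k ≤ k.centralBinom := by
    intro k
    induction k with
    | zero => simp
    | succ k ih =>
      have h1 := Nat.succ_mul_centralBinom_succ k
      have h2 : (k + 1) * 2 ^ (k + 1) ≤ (k + 1) * (k + 1).centralBinom := by
        rw [h1, pow_succ]
        nlinarith [Nat.zero_le (k * k.centralBinom)]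
      exact Nat.le_of_mul_le_mul_left h2 k.succ_pos
  exact (h _).trans (Nat.choose_le_choose _ (Nat.mul_div_le N 2))

theorem choose_pow_three_lt {N m : ℕ} (hN : 216 ≤ N) (hm : 216 * m ≤ N) :
    N.choose m ^ 3 < 2 ^ (N / 2) := by
  set t := N / 44 + 1 with ht
  have h1 : (N.choose m : ℝ) * (1 / 64) ^ m ≤ (65 / 64) ^ N := by
    have h := add_pow (1 / 64 : ℝ) 1 N
    rw [show (65 / 64 : ℝ) = 1 / 64 + 1 by norm_num, h]
    have := Finset.single_le_sum (s := Finset.range (N + 1))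
      (f := fun j => (1 / 64 : ℝ) ^ j * 1 ^ (N - j) * (N.choose j))
      (fun j _ => by positivity) (Finset.mem_range.2 (show m < N + 1 by omega))
    simpa [mul_comm] using this
  have h2 : (65 / 64 : ℝ) ^ N ≤ 2 ^ t := by
    calc (65 / 64 : ℝ) ^ N ≤ (65 / 64) ^ (44 * t) :=
          pow_le_pow_right₀ (by norm_num) (by omega)
      _ = ((65 / 64) ^ 44) ^ t := pow_mul _ _ _
      _ ≤ 2 ^ t := pow_le_pow_left₀ (by norm_num) (by norm_num) _
  have h3 : (N.choose m : ℝ) ≤ 2 ^ (t + 6 * m) := by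
    have h64 : (2 : ℝ) ^ (6 * m) * (1 / 64) ^ m = 1 := by
      rw [pow_mul, ← mul_pow]; norm_num
    calc (N.choose m : ℝ) = N.choose m * (1 / 64) ^ m * 2 ^ (6 * m) := by
          rw [mul_assoc, mul_comm ((1 / 64 : ℝ) ^ m), h64, mul_one]
      _ ≤ 2 ^ t * 2 ^ (6 * m) := by gcongr; exact h1.trans h2
      _ = _ := (pow_add _ _ _).symm
  have h4 : N.choose m ≤ 2 ^ (t + 6 * m) := by exact_mod_cast h3
  calc N.choose m ^ 3 ≤ (2 ^ (t + 6 * m)) ^ 3 := Nat.pow_le_pow_left h4 3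
    _ = 2 ^ ((t + 6 * m) * 3) := (pow_mul _ _ _).symm
    _ < 2 ^ (N / 2) := Nat.pow_lt_pow_right (by norm_num) (by omega)

theorem mul_ceil_pred_le {r n : ℕ} (hr : 3 ≤ r) (hn : 6 ^ r < n) :
    216 * (⌈(1 / (12 * (r : ℝ))) * (n : ℝ) ^ (((r : ℝ) - 1) / (r : ℝ))⌉₊ - 1) ≤ n := by
  have hr' : (3 : ℝ) ≤ r := by exact_mod_cast hr
  have hr0 : (0 : ℝ) < r := by linarith
  have hn' : (6 : ℝ) ^ r < n := by exact_mod_cast hn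
  have hn0 : (0 : ℝ) < n := lt_trans (by positivity) hn'
  set x := (1 / (12 * (r : ℝ))) * (n : ℝ) ^ (((r : ℝ) - 1) / (r : ℝ)) with hx
  have hroot : (6 : ℝ) ≤ (n : ℝ) ^ (1 / (r : ℝ)) := by
    rw [Real.le_rpow_iff_log_le (by norm_num) hn0]
    have := Real.log_le_log (by positivity) hn'.le
    rw [Real.log_pow] at this
    rw [one_div, inv_mul_eq_div, le_div_iff₀ hr0]
    linarith
  have hsplit : (n : ℝ) ^ (((r : ℝ) - 1) / (r : ℝ)) * (n : ℝ) ^ (1 / (r : ℝ)) = n := by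
    rw [← Real.rpow_add hn0, ← add_div, sub_add_cancel, div_self hr0.ne', Real.rpow_one]
  set y := (n : ℝ) ^ (((r : ℝ) - 1) / (r : ℝ)) with hy
  have hy0 : 0 < y := Real.rpow_pos_of_pos hn0 _
  have hy6 : y * 6 ≤ n := by
    rw [← hsplit]; gcongr
  have hx36 : 36 * x ≤ y := by
    have : x * (12 * r) = y := by rw [hx]; field_simp
    have hx0 : 0 < x := by rw [hx]; positivity
    nlinarith
  have hx0 : 0 < x := by rw [hx]; positivity
  have hlt : ((⌈x⌉₊ - 1 : ℕ) : ℝ) < x := by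
    have h1 : 1 ≤ ⌈x⌉₊ := Nat.one_le_ceil_iff.2 hx0
    have := Nat.ceil_lt_add_one hx0.le
    push_cast [Nat.cast_sub h1]
    linarith
  have : ((216 * (⌈x⌉₊ - 1) : ℕ) : ℝ) ≤ n := by
    rw [Nat.cast_mul]
    push_cast only [Nat.cast_ofNat]
    linarith
  exact_mod_cast this

/-- The edge of `Fin r × Fin N` whose vertex in the part `p` is `(p, g p)`. -/
def graphEdge {r N : ℕ} (g : Fin r → Fin N) : Finset (Fin r × Fin N) :=
  Finset.univ.map ⟨fun p => (p, g p), fun _ _ h => congrArg Prod.fst h⟩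

theorem mem_graphEdge {r N : ℕ} {g : Fin r → Fin N} {v : Fin r × Fin N} :
    v ∈ graphEdge g ↔ g v.1 = v.2 := by
  constructor
  · simp only [graphEdge, Finset.mem_map, Finset.mem_univ, true_and]
    rintro ⟨p, rfl⟩
    rfl
  · intro h
    simp only [graphEdge, Finset.mem_map, Finset.mem_univ, true_and]
    exact ⟨v.1, Prod.ext rfl h⟩

theorem isPartiteEdge_graphEdge {r N : ℕ} (g : Fin r → Fin N) :
    IsPartiteEdge r Prod.fst (graphEdge g) := by
  intro p
  rw [Finset.card_eq_one]
  refine ⟨(p, g p), ?_⟩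
  ext ⟨q, x⟩
  simp only [Finset.mem_filter, mem_graphEdge, Finset.mem_singleton, Prod.mk.injEq]
  constructor
  · rintro ⟨rfl, rfl⟩; exact ⟨rfl, rfl⟩
  · rintro ⟨rfl, rfl⟩; exact ⟨rfl, rfl⟩

/-- The matching formed by the edges `{(p, π p x) | p}`, one for each `x`. -/
def permMatching {r N : ℕ} (π : Fin r → Equiv.Perm (Fin N)) :
    Finset (Finset (Fin r × Fin N)) :=
  Finset.univ.image fun x => graphEdge fun p => π p x

theorem mem_permMatching {r N : ℕ} {π : Fin r → Equiv.Perm (Fin N)}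
    {e : Finset (Fin r × Fin N)} :
    e ∈ permMatching π ↔ ∃ x, graphEdge (fun p => π p x) = e := by
  simp [permMatching]

theorem isMatching_permMatching {r N : ℕ} (π : Fin r → Equiv.Perm (Fin N)) :
    IsMatching r (permMatching π) := by
  constructor
  · intro e he
    obtain ⟨x, rfl⟩ := mem_permMatching.1 he
    simp [graphEdge]
  · intro e he f hf hne
    obtain ⟨x, rfl⟩ := mem_permMatching.1 he
    obtain ⟨y, rfl⟩ := mem_permMatching.1 hf
    rw [Finset.disjoint_left]
    intro v hv hw
    rw [mem_graphEdge] at hv hw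
    have : x = y := (π v.1).injective (hv.trans hw.symm)
    exact hne (by rw [this])

theorem card_permMatching {r N : ℕ} (hr : 0 < r) (π : Fin r → Equiv.Perm (Fin N)) :
    (permMatching π).card = N := by
  rw [permMatching, Finset.card_image_of_injective, Finset.card_univ, Fintype.card_fin]
  intro x y hxy
  have hx : ((⟨0, hr⟩ : Fin r), π ⟨0, hr⟩ x) ∈ graphEdge fun p => π p x :=
    mem_graphEdge.2 rfl
  simp only at hxy
  rw [hxy, mem_graphEdge] at hx
  exact (π ⟨0, hr⟩).injective hx.symm

open Finset in
/-- In a full rainbow matching for `k` copies of `permMatching π` and `n - k` copies of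
`permMatching 1`, the former edges have their support in a set of size `k + m`. -/
theorem HasRainbow.exists_mapsTo {r n m k : ℕ} (hr : 0 < r) (hk : k ≤ n)
    {π : Fin r → Equiv.Perm (Fin (n + m))}
    (h : HasRainbow (fun i : Fin n => if i.1 < k then permMatching π else permMatching 1) n) :
    ∃ S T : Finset (Fin (n + m)), #S = k ∧ #T = k + m ∧ ∀ p, ∀ x ∈ S, π p x ∈ T := by
  obtain ⟨c, e, hc, he, hd⟩ := h
  have hsurj : Function.Surjective c := Finite.surjective_of_injective hc
  have hpre : ∀ i : Fin n, ∃ x : Fin (n + m), ∃ j, c j = i ∧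
      graphEdge (fun p => (if i.1 < k then π p else 1) x) = e j := by
    intro i
    obtain ⟨j, rfl⟩ := hsurj i
    have := he j
    dsimp only at this
    split_ifs at this with hi
    · obtain ⟨x, hx⟩ := mem_permMatching.1 this
      exact ⟨x, j, rfl, by simpa [hi] using hx⟩
    · obtain ⟨x, hx⟩ := mem_permMatching.1 this
      exact ⟨x, j, rfl, by simpa [hi] using hx⟩
  choose a b hb hab using hpre
  have hne : ∀ i i' : Fin n, i ≠ i' → ∀ p,
      (if i.1 < k then π p else 1) (a i) ≠ (if i'.1 < k then π p else 1) (a i') := by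
    intro i i' hii p heq
    have hbne : b i ≠ b i' := fun hh => hii (by rw [← hb i, ← hb i', hh])
    have hdis := hd _ _ hbne
    rw [← hab, ← hab, disjoint_left] at hdis
    exact hdis (a := (p, (if i.1 < k then π p else 1) (a i)))
      (mem_graphEdge.2 rfl) (mem_graphEdge.2 heq.symm)
  have hlow : #{i : Fin n | i.1 < k} = k := by
    rw [Fin.card_filter_val_lt]; omega
  have hhigh : #{i : Fin n | ¬ i.1 < k} = n - k := by
    have := card_filter_add_card_filter_not (s := (univ : Finset (Fin n))) (fun i => i.1 < k)
    rw [hlow, card_univ, Fintype.card_fin] at this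
    omega
  refine ⟨({i : Fin n | i.1 < k} : Finset _).image a,
    (({i : Fin n | ¬ i.1 < k} : Finset _).image a)ᶜ, ?_, ?_, ?_⟩
  · rw [card_image_of_injOn, hlow]
    intro i hi i' hi' heq
    simp only [coe_filter, mem_univ, true_and, Set.mem_ofPred_eq] at hi hi'
    by_contra hii
    have := hne i i' hii ⟨0, hr⟩
    simp [hi, hi', heq] at this
  · rw [card_compl, card_image_of_injOn, hhigh, Fintype.card_fin]
    · omega
    intro i hi i' hi' heq
    simp only [coe_filter, mem_univ, true_and, Set.mem_ofPred_eq] at hi hi'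
    by_contra hii
    have := hne i i' hii ⟨0, hr⟩
    simp only [if_neg hi, if_neg hi', heq, ne_eq, not_true_eq_false] at this
  · intro p x hx
    obtain ⟨i, hi, rfl⟩ := mem_image.1 hx
    rw [mem_filter_univ] at hi
    rw [mem_compl, mem_image]
    rintro ⟨i', hi', heq⟩
    rw [mem_filter_univ] at hi'
    have := hne i i' (fun hh => hi' (hh ▸ hi)) p
    rw [if_pos hi, if_neg hi'] at this
    exact this heq.symm

/-- Theorem 2.7 (lower bound on h(r,n)): for r ≥ 3 and n > 6^r there are n matchings,
each of size n + ⌈n^((r-1)/r)/(12r)⌉ - 1, in an r-partite r-uniform hypergraph with no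
rainbow matching of size n. -/
theorem stmt6 (r n : ℕ) (hr : 3 ≤ r) (hn : 6 ^ r < n) :
    ∃ (V : Type) (P : V → Fin r) (M : Fin n → Finset (Finset V)),
      (∀ i, IsMatching r (M i) ∧
        (M i).card =
          n + (⌈(1 / (12 * (r : ℝ))) * (n : ℝ) ^ (((r : ℝ) - 1) / (r : ℝ))⌉₊ - 1) ∧
        ∀ e ∈ M i, IsPartiteEdge r P e) ∧
      ¬ HasRainbow M n := by
  have hm := mul_ceil_pred_le hr hn
  set m := ⌈(1 / (12 * (r : ℝ))) * (n : ℝ) ^ (((r : ℝ) - 1) / (r : ℝ))⌉₊ - 1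
  have h216 : 216 ≤ n := by
    have : 6 ^ 3 ≤ 6 ^ r := Nat.pow_le_pow_right (by norm_num) hr
    omega
  set k := (n + m) / 2 with hk
  have hchoose : (n + m).choose m * ((k + m).choose k) ^ 2 < (n + m).choose k := by
    have h1 : (k + m).choose k ≤ (n + m).choose m := by
      rw [Nat.choose_symm_add]
      exact Nat.choose_le_choose _ (by omega)
    calc (n + m).choose m * ((k + m).choose k) ^ 2
        ≤ (n + m).choose m * ((n + m).choose m) ^ 2 := by gcongr
      _ = (n + m).choose m ^ 3 := by ring
      _ < 2 ^ k := choose_pow_three_lt (by omega) (by omega)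
      _ ≤ _ := two_pow_le_choose_half _
  obtain ⟨σ, τ, hστ⟩ := exists_perm_pair_expanding (by omega) hchoose
  set π : Fin r → Equiv.Perm (Fin (n + m)) := fun p =>
    if p.1 = 0 then 1 else if p.1 = 1 then σ else τ with hπ
  refine ⟨Fin r × Fin (n + m), Prod.fst,
    fun i => if i.1 < k then permMatching π else permMatching 1, fun i => ?_, fun h => ?_⟩
  · have hprop : ∀ ρ : Fin r → Equiv.Perm (Fin (n + m)), IsMatching r (permMatching ρ) ∧
        (permMatching ρ).card = n + m ∧
        ∀ e ∈ permMatching ρ, IsPartiteEdge r Prod.fst e := by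
      refine fun ρ => ⟨isMatching_permMatching ρ, card_permMatching (by omega) ρ, ?_⟩
      intro e he
      obtain ⟨x, rfl⟩ := mem_permMatching.1 he
      exact isPartiteEdge_graphEdge _
    dsimp only
    split_ifs
    · exact hprop π
    · exact hprop 1
  · obtain ⟨S, T, hS, hT, hST⟩ := h.exists_mapsTo (by omega) (by omega)
    refine hστ S T hS hT (fun x hx => ?_) (fun x hx => ?_) (fun x hx => ?_)
    · exact hST ⟨0, by omega⟩ x hx
    · exact hST ⟨1, by omega⟩ x hx
    · exact hST ⟨2, by omega⟩ x hx
end
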